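/- Let x ∈ (0,∞) and a, b, c, d ∈ ℂ with positive real parts (non-real parameters in conjugate pairs). Then the Wilson polynomial admits the representation W_n(x²; a,b,c,d) = n! Σ_{k=0}^n u_k(ix) u_{n−k}(−ix) (2ix − n + 2k)/(2ix), where u_k(y) = (a+y)_k (b+y)_k (c+y)_k (d+y)_k / (k! (1+2y)_k). -/

import Mathlib

open Complex Finset

/-- The Pochhammer symbol (rising factorial) `(z)_n = z(z+1)⋯(z+n-1)`. -/
noncomputable def poch (z : ℂ) (n : ℕ) : ℂ := ∏ i ∈ Finset.range n, (z + i)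

/-- The Wilson polynomial `W_n(x²; a, b, c, d)` via its terminating `₄F₃`
representation. -/
noncomputable def wilson (n : ℕ) (x : ℝ) (a b c d : ℂ) : ℂ :=
  poch (a + b) n * poch (a + c) n * poch (a + d) n *
    ∑ j ∈ Finset.range (n + 1),
      poch (-(n : ℂ)) j * poch ((n : ℂ) + a + b + c + d - 1) j *
          poch (a + Complex.I * x) j * poch (a - Complex.I * x) j /
        (poch (a + b) j * poch (a + c) j * poch (a + d) j * j.factorial)

/-- Wilson's auxiliary function `u_k(y)`. -/
noncomputable def wilsonU (a b c d y : ℂ) (k : ℕ) : ℂ :=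
  poch (a + y) k * poch (b + y) k * poch (c + y) k * poch (d + y) k /
    ((k.factorial : ℂ) * poch (1 + 2 * y) k)

theorem poch_zero (z : ℂ) : poch z 0 = 1 := by simp [poch]

theorem poch_succ (z : ℂ) (n : ℕ) : poch z (n + 1) = poch z n * (z + n) := by
  simp [poch, Finset.prod_range_succ]

theorem poch_succ_left (z : ℂ) (n : ℕ) : poch z (n + 1) = z * poch (z + 1) n := by
  simp only [poch, Finset.prod_range_succ']
  rw [mul_comm]
  congr 1
  · simp
  · refine Finset.prod_congr rfl fun i _ => ?_
    push_cast
    ring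

theorem poch_add (z : ℂ) (m n : ℕ) : poch z (m + n) = poch z m * poch (z + m) n := by
  simp only [poch, Finset.prod_range_add]
  congr 1
  refine Finset.prod_congr rfl fun i _ => ?_
  push_cast
  ring

theorem poch_ne_zero {z : ℂ} (h : ∀ i : ℕ, z + i ≠ 0) (n : ℕ) : poch z n ≠ 0 :=
  Finset.prod_ne_zero_iff.mpr fun i _ => h i

theorem poch_neg_succ_self (n : ℕ) : poch (-(n : ℂ)) (n + 1) = 0 := by
  rw [poch_succ]
  simp

/-- The coefficient of `(a + y)_j (a - y)_j` in the Wilson polynomial of degree `n`. -/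
noncomputable def wilsonCoeff (n j : ℕ) (a b c d : ℂ) : ℂ :=
  poch (a + b + j) (n - j) * poch (a + c + j) (n - j) * poch (a + d + j) (n - j) *
    (poch (-(n : ℂ)) j * poch (n + a + b + c + d - 1) j / j.factorial)

/-- The Wilson polynomial as a function of `y = i x`, free of denominators depending on the
parameters. -/
noncomputable def wilsonPoly (n : ℕ) (y a b c d : ℂ) : ℂ :=
  ∑ j ∈ Finset.range (n + 1), wilsonCoeff n j a b c d * (poch (a + y) j * poch (a - y) j)

theorem wilson_eq_wilsonPoly (n : ℕ) (x : ℝ) {a b c d : ℂ}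
    (hab : ∀ i : ℕ, a + b + i ≠ 0) (hac : ∀ i : ℕ, a + c + i ≠ 0)
    (had : ∀ i : ℕ, a + d + i ≠ 0) :
    wilson n x a b c d = wilsonPoly n (Complex.I * x) a b c d := by
  rw [wilson, wilsonPoly, Finset.mul_sum]
  refine Finset.sum_congr rfl fun j hj => ?_
  obtain ⟨m, rfl⟩ := Nat.exists_eq_add_of_le (Nat.lt_succ_iff.mp (Finset.mem_range.mp hj))
  have h1 := poch_ne_zero hab j
  have h2 := poch_ne_zero hac j
  have h3 := poch_ne_zero had j
  have h4 : (j.factorial : ℂ) ≠ 0 := Nat.cast_ne_zero.mpr j.factorial_ne_zero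
  rw [wilsonCoeff, Nat.add_sub_cancel_left, poch_add (a + b), poch_add (a + c), poch_add (a + d)]
  field_simp

theorem wilsonCoeff_succ_zero (n : ℕ) (a b c d : ℂ) :
    wilsonCoeff (n + 1) 0 a b c d =
      (a + b) * (a + c) * (a + d) *
        wilsonCoeff n 0 (a + 1 / 2) (b + 1 / 2) (c + 1 / 2) (d + 1 / 2) := by
  have h (p : ℂ) : a + 1 / 2 + (p + 1 / 2) = a + p + 1 := by ring
  simp only [wilsonCoeff, poch_zero, Nat.sub_zero, poch_succ_left, h, Nat.cast_zero, add_zero]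
  ring

theorem wilsonCoeff_succ_succ {n j : ℕ} (hj : j ≤ n) (a b c d : ℂ) :
    wilsonCoeff (n + 1) (j + 1) a b c d =
      (a + b + (j + 1)) * (a + c + (j + 1)) * (a + d + (j + 1)) *
          wilsonCoeff n (j + 1) (a + 1 / 2) (b + 1 / 2) (c + 1 / 2) (d + 1 / 2) -
        (a + b + c + d + j) *
          wilsonCoeff n j (a + 1 / 2) (b + 1 / 2) (c + 1 / 2) (d + 1 / 2) := by
  have hf : (j.factorial : ℂ) ≠ 0 := Nat.cast_ne_zero.mpr j.factorial_ne_zero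
  have hj1 : (j : ℂ) + 1 ≠ 0 := Nat.cast_add_one_ne_zero j
  have hs (p : ℂ) : a + 1 / 2 + (p + 1 / 2) + j = a + p + ((j + 1 : ℕ) : ℂ) := by
    push_cast
    ring
  have hs' (p : ℂ) : a + 1 / 2 + (p + 1 / 2) + ((j + 1 : ℕ) : ℂ) = a + p + (j + 1) + 1 := by
    push_cast
    ring
  have hn : (n : ℂ) + (a + 1 / 2) + (b + 1 / 2) + (c + 1 / 2) + (d + 1 / 2) - 1 =
      n + a + b + c + d + 1 := by ring
  have hn' : ((n + 1 : ℕ) : ℂ) + a + b + c + d - 1 = n + a + b + c + d := by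
    push_cast
    ring
  have hneg : -((n + 1 : ℕ) : ℂ) + 1 = -(n : ℂ) := by
    push_cast
    ring
  have hfac : (((j + 1).factorial : ℕ) : ℂ) = (j + 1) * j.factorial := by
    rw [Nat.factorial_succ]
    push_cast
    ring
  obtain rfl | hlt := hj.eq_or_lt
  · simp only [wilsonCoeff, hn, hn', Nat.sub_self, poch_zero, poch_neg_succ_self, hfac]
    rw [poch_succ_left (-((j + 1 : ℕ) : ℂ)), hneg, poch_succ_left (j + a + b + c + d)]
    push_cast
    field_simp
    ring
  · obtain ⟨m, rfl⟩ := Nat.exists_eq_add_of_lt hlt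
    have e1 : j + m + 1 + 1 - (j + 1) = m + 1 := by omega
    have e2 : j + m + 1 - (j + 1) = m := by omega
    have e3 : j + m + 1 - j = m + 1 := by omega
    simp only [wilsonCoeff, hn, hn', hs, hs', e1, e2, e3, hfac]
    rw [poch_succ_left (-((j + m + 1 + 1 : ℕ) : ℂ)), hneg,
      poch_succ_left ((j + m + 1 : ℕ) + a + b + c + d), poch_succ (-((j + m + 1 : ℕ) : ℂ)) j,
      poch_succ ((j + m + 1 : ℕ) + a + b + c + d + 1) j]
    simp only [poch_succ_left _ m]
    push_cast
    field_simp
    ring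

theorem wilsonCoeff_self_succ (n : ℕ) (a b c d : ℂ) : wilsonCoeff n (n + 1) a b c d = 0 := by
  simp [wilsonCoeff, poch_neg_succ_self]

theorem raising_basis (j : ℕ) (y a b c d : ℂ) :
    (a + y) * (b + y) * (c + y) * (d + y) *
          (poch (a + 1 / 2 + (y + 1 / 2)) j * poch (a + 1 / 2 - (y + 1 / 2)) j) -
        (a - y) * (b - y) * (c - y) * (d - y) *
          (poch (a + 1 / 2 + (y - 1 / 2)) j * poch (a + 1 / 2 - (y - 1 / 2)) j) =
      2 * y * ((a + b + j) * (a + c + j) * (a + d + j) * (poch (a + y) j * poch (a - y) j) -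
        (a + b + c + d + j) * (poch (a + y) (j + 1) * poch (a - y) (j + 1))) := by
  have h1 : a + 1 / 2 + (y + 1 / 2) = a + y + 1 := by ring
  have h2 : a + 1 / 2 - (y + 1 / 2) = a - y := by ring
  have h3 : a + 1 / 2 + (y - 1 / 2) = a + y := by ring
  have h4 : a + 1 / 2 - (y - 1 / 2) = a - y + 1 := by ring
  have hp : (a + y) * poch (a + y + 1) j = poch (a + y) j * (a + y + j) := by
    rw [← poch_succ_left, poch_succ]
  have hm : (a - y) * poch (a - y + 1) j = poch (a - y) j * (a - y + j) := by
    rw [← poch_succ_left, poch_succ]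
  rw [h1, h2, h3, h4, poch_succ, poch_succ]
  linear_combination (b + y) * (c + y) * (d + y) * poch (a - y) j * hp -
    (b - y) * (c - y) * (d - y) * poch (a + y) j * hm

theorem wilsonPoly_succ (n : ℕ) (y a b c d : ℂ) :
    2 * y * wilsonPoly (n + 1) y a b c d =
      (a + y) * (b + y) * (c + y) * (d + y) *
          wilsonPoly n (y + 1 / 2) (a + 1 / 2) (b + 1 / 2) (c + 1 / 2) (d + 1 / 2) -
        (a - y) * (b - y) * (c - y) * (d - y) *
          wilsonPoly n (y - 1 / 2) (a + 1 / 2) (b + 1 / 2) (c + 1 / 2) (d + 1 / 2) := by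
  set C : ℕ → ℂ := fun j => wilsonCoeff n j (a + 1 / 2) (b + 1 / 2) (c + 1 / 2) (d + 1 / 2)
  set φ : ℕ → ℂ := fun j => poch (a + y) j * poch (a - y) j
  set A : ℕ → ℂ := fun j => (a + b + j) * (a + c + j) * (a + d + j)
  have hR : (a + y) * (b + y) * (c + y) * (d + y) *
          wilsonPoly n (y + 1 / 2) (a + 1 / 2) (b + 1 / 2) (c + 1 / 2) (d + 1 / 2) -
        (a - y) * (b - y) * (c - y) * (d - y) *
          wilsonPoly n (y - 1 / 2) (a + 1 / 2) (b + 1 / 2) (c + 1 / 2) (d + 1 / 2) =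
      2 * y * (∑ j ∈ Finset.range (n + 1), A j * C j * φ j -
        ∑ j ∈ Finset.range (n + 1), (a + b + c + d + j) * C j * φ (j + 1)) := by
    simp only [wilsonPoly]
    rw [Finset.mul_sum, Finset.mul_sum, ← Finset.sum_sub_distrib, ← Finset.sum_sub_distrib,
      Finset.mul_sum]
    refine Finset.sum_congr rfl fun j _ => ?_
    linear_combination C j * raising_basis j y a b c d
  have hlast : ∑ j ∈ Finset.range (n + 1), A j * C j * φ j =
      ∑ j ∈ Finset.range (n + 1), A (j + 1) * C (j + 1) * φ (j + 1) + A 0 * C 0 * φ 0 := by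
    rw [← Finset.sum_range_succ' (fun j => A j * C j * φ j), Finset.sum_range_succ _ (n + 1)]
    simp [C, wilsonCoeff_self_succ]
  rw [hR, hlast, wilsonPoly, Finset.sum_range_succ', wilsonCoeff_succ_zero, add_sub_right_comm,
    ← Finset.sum_sub_distrib]
  congr 2
  · refine Finset.sum_congr rfl fun j hj => ?_
    rw [wilsonCoeff_succ_succ (Nat.lt_succ_iff.mp (Finset.mem_range.mp hj))]
    simp only [A, C, φ]
    push_cast
    ring
  · simp [A, C, φ]

theorem wilsonU_shift_up (k : ℕ) {y : ℂ} (a b c d : ℂ) (hy : 1 + 2 * y ≠ 0) :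
    (a + y) * (b + y) * (c + y) * (d + y) *
        wilsonU (a + 1 / 2) (b + 1 / 2) (c + 1 / 2) (d + 1 / 2) (y + 1 / 2) k =
      (k + 1) * (1 + 2 * y) * wilsonU a b c d y (k + 1) := by
  have h (p : ℂ) : p + 1 / 2 + (y + 1 / 2) = p + y + 1 := by ring
  have h2 : 1 + 2 * (y + 1 / 2) = 1 + 2 * y + 1 := by ring
  have hk : (k : ℂ) + 1 ≠ 0 := Nat.cast_add_one_ne_zero k
  simp only [wilsonU, poch_succ_left _ k, Nat.factorial_succ, h, h2]
  push_cast
  rw [mul_div_assoc', mul_div_assoc',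
    ← mul_div_mul_left _ _ (mul_ne_zero hk hy)]
  congr 1 <;> ring

theorem wilsonU_shift_down (k : ℕ) {y : ℂ} (a b c d : ℂ) (hy : ∀ i : ℕ, 2 * y + i ≠ 0) :
    wilsonU (a + 1 / 2) (b + 1 / 2) (c + 1 / 2) (d + 1 / 2) (y - 1 / 2) k =
      wilsonU a b c d y k * (2 * y + k) / (2 * y) := by
  have h (p : ℂ) : p + 1 / 2 + (y - 1 / 2) = p + y := by ring
  have h2 : 1 + 2 * (y - 1 / 2) = 2 * y := by ring
  have hy0 : 2 * y ≠ 0 := by simpa using hy 0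
  have hp : poch (1 + 2 * y) k = poch (2 * y) k * (2 * y + k) / (2 * y) := by
    rw [← poch_succ, poch_succ_left, add_comm 1, mul_div_cancel_left₀ _ hy0]
  have hq := poch_ne_zero hy k
  have hk := hy k
  have hf : (k.factorial : ℂ) ≠ 0 := Nat.cast_ne_zero.mpr k.factorial_ne_zero
  simp only [wilsonU, h, h2, hp]
  generalize 2 * y = t at hy0 hq hk ⊢
  field_simp

/-- The symmetrized sum as a function of `y = i x`. -/
noncomputable def wilsonSym (n : ℕ) (y a b c d : ℂ) : ℂ :=
  n.factorial * ∑ p ∈ Finset.HasAntidiagonal.antidiagonal n,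
    wilsonU a b c d y p.1 * wilsonU a b c d (-y) p.2 * (2 * y + p.1 - p.2) / (2 * y)

theorem sum_antidiagonal_fst_mul (n : ℕ) (f : ℕ → ℕ → ℂ) :
    ∑ p ∈ Finset.HasAntidiagonal.antidiagonal (n + 1), (p.1 : ℂ) * f p.1 p.2 =
      ∑ p ∈ Finset.HasAntidiagonal.antidiagonal n, ((p.1 : ℂ) + 1) * f (p.1 + 1) p.2 := by
  rw [Finset.Nat.sum_antidiagonal_succ]
  simp

theorem sum_antidiagonal_snd_mul (n : ℕ) (f : ℕ → ℕ → ℂ) :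
    ∑ p ∈ Finset.HasAntidiagonal.antidiagonal (n + 1), (p.2 : ℂ) * f p.1 p.2 =
      ∑ p ∈ Finset.HasAntidiagonal.antidiagonal n, ((p.2 : ℂ) + 1) * f p.1 (p.2 + 1) := by
  rw [Finset.Nat.sum_antidiagonal_succ']
  simp

theorem two_mul_add_natCast_ne_zero {y : ℂ} (hy : y.im ≠ 0) (i : ℕ) : 2 * y + i ≠ 0 := by
  intro h
  have := congrArg Complex.im h
  simp [hy] at this

theorem wilsonSym_succ (n : ℕ) {y : ℂ} (a b c d : ℂ) (hy : y.im ≠ 0) :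
    2 * y * wilsonSym (n + 1) y a b c d =
      (a + y) * (b + y) * (c + y) * (d + y) *
          wilsonSym n (y + 1 / 2) (a + 1 / 2) (b + 1 / 2) (c + 1 / 2) (d + 1 / 2) -
        (a - y) * (b - y) * (c - y) * (d - y) *
          wilsonSym n (y - 1 / 2) (a + 1 / 2) (b + 1 / 2) (c + 1 / 2) (d + 1 / 2) := by
  have hy' : (-y).im ≠ 0 := by simpa using hy
  have hy0 : y ≠ 0 := fun h => hy (by simp [h])
  have hp : 1 + 2 * y ≠ 0 := by simpa [add_comm] using two_mul_add_natCast_ne_zero hy 1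
  have hm : 1 + 2 * -y ≠ 0 := by simpa [add_comm] using two_mul_add_natCast_ne_zero hy' 1
  set g : ℕ → ℕ → ℂ := fun k l =>
    wilsonU a b c d y k * wilsonU a b c d (-y) l * (2 * y + k - l) / (2 * y)
  have hplus : (a + y) * (b + y) * (c + y) * (d + y) *
        wilsonSym n (y + 1 / 2) (a + 1 / 2) (b + 1 / 2) (c + 1 / 2) (d + 1 / 2) =
      n.factorial * ∑ p ∈ Finset.HasAntidiagonal.antidiagonal (n + 1), p.1 * (g p.1 p.2 * (2 * y - p.2)) := by
    rw [sum_antidiagonal_fst_mul n fun k l => g k l * (2 * y - l), wilsonSym, mul_left_comm,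
      Finset.mul_sum]
    congr 1
    refine Finset.sum_congr rfl fun p _ => ?_
    have hu := wilsonU_shift_up p.1 a b c d hp
    have hd := wilsonU_shift_down p.2 a b c d (two_mul_add_natCast_ne_zero hy')
    rw [show -y - 1 / 2 = -(y + 1 / 2) by ring] at hd
    rw [hd, mul_div_assoc', ← mul_assoc, ← mul_assoc, hu]
    have h2 : 2 * (y + 1 / 2) = 1 + 2 * y := by ring
    simp only [g, h2]
    push_cast
    field_simp
    ring
  have hminus : (a - y) * (b - y) * (c - y) * (d - y) *
        wilsonSym n (y - 1 / 2) (a + 1 / 2) (b + 1 / 2) (c + 1 / 2) (d + 1 / 2) =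
      -(n.factorial * ∑ p ∈ Finset.HasAntidiagonal.antidiagonal (n + 1), p.2 * (g p.1 p.2 * (2 * y + p.1))) := by
    rw [sum_antidiagonal_snd_mul n fun k l => g k l * (2 * y + k), wilsonSym, mul_left_comm,
      Finset.mul_sum, ← mul_neg, ← Finset.sum_neg_distrib]
    congr 1
    refine Finset.sum_congr rfl fun p _ => ?_
    have hu := wilsonU_shift_up p.2 a b c d hm
    have hd := wilsonU_shift_down p.1 a b c d (two_mul_add_natCast_ne_zero hy)
    rw [show -y + 1 / 2 = -(y - 1 / 2) by ring] at hu
    simp only [← sub_eq_add_neg] at hu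
    rw [hd, mul_div_assoc', ← mul_assoc, mul_left_comm, hu]
    have h2 : 2 * (y - 1 / 2) = 2 * y - 1 := by ring
    have hm2 : 2 * y - 1 ≠ 0 := fun h => hm (by linear_combination -h)
    simp only [g, h2]
    push_cast
    field_simp
    ring
  rw [hplus, hminus, sub_neg_eq_add, ← mul_add, ← Finset.sum_add_distrib, wilsonSym,
    Nat.factorial_succ, mul_left_comm, Nat.cast_mul, mul_comm ((n + 1 : ℕ) : ℂ), mul_assoc]
  congr 1
  rw [Finset.mul_sum, Finset.mul_sum]
  refine Finset.sum_congr rfl fun p hp => ?_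
  rw [← Finset.HasAntidiagonal.mem_antidiagonal.mp hp]
  simp only [g]
  push_cast
  ring

theorem wilsonPoly_eq_wilsonSym (n : ℕ) {y : ℂ} (a b c d : ℂ) (hy : y.im ≠ 0) :
    wilsonPoly n y a b c d = wilsonSym n y a b c d := by
  induction n generalizing y a b c d with
  | zero =>
    have hy0 : y ≠ 0 := fun h => hy (by simp [h])
    simp [wilsonPoly, wilsonCoeff, wilsonSym, wilsonU, poch_zero, hy0]
  | succ n ih =>
    have hy0 : 2 * y ≠ 0 := by simpa using two_mul_add_natCast_ne_zero hy 0
    refine mul_left_cancel₀ hy0 ?_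
    rw [wilsonPoly_succ, wilsonSym_succ n a b c d hy, ih _ _ _ _ (by simpa using hy),
      ih _ _ _ _ (by simpa using hy)]

theorem add_natCast_ne_zero_of_re_pos {z : ℂ} (hz : 0 < z.re) (i : ℕ) : z + i ≠ 0 := by
  intro h
  have h' := congrArg Complex.re h
  simp only [Complex.add_re, Complex.natCast_re, Complex.zero_re] at h'
  have : (0 : ℝ) ≤ i := i.cast_nonneg
  linarith

theorem wilson_symmetrization (x : ℝ) (hx : 0 < x) (a b c d : ℂ)
    (ha : 0 < a.re) (hb : 0 < b.re) (hc : 0 < c.re) (hd : 0 < d.re)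
    (hconj : ({a, b, c, d} : Multiset ℂ).map (starRingEnd ℂ) =
      ({a, b, c, d} : Multiset ℂ)) (n : ℕ) :
    wilson n x a b c d =
      (n.factorial : ℂ) *
        ∑ k ∈ Finset.range (n + 1),
          wilsonU a b c d (Complex.I * x) k * wilsonU a b c d (-(Complex.I * x)) (n - k) *
            (2 * Complex.I * x - n + 2 * k) / (2 * Complex.I * x) := by
  rw [wilson_eq_wilsonPoly n x
      (add_natCast_ne_zero_of_re_pos (by simpa using add_pos ha hb))
      (add_natCast_ne_zero_of_re_pos (by simpa using add_pos ha hc))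
      (add_natCast_ne_zero_of_re_pos (by simpa using add_pos ha hd)),
    wilsonPoly_eq_wilsonSym n a b c d (by simpa using hx.ne'), wilsonSym,
    Finset.Nat.sum_antidiagonal_eq_sum_range_succ_mk]
  congr 1
  refine Finset.sum_congr rfl fun k hk => ?_
  rw [Nat.cast_sub (Nat.lt_succ_iff.mp (Finset.mem_range.mp hk))]
  ring
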